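/- arXiv:2604.22244 — 6 statements merged into one kernel-verified Lean document; each statement's English description precedes it below -/
import Mathlib

section
/- Let n, m be natural numbers, f : ℝ^n × ℝ^m → ℝ^n, S ⊆ ℝ^n, U ⊆ ℝ^m, C : ℝ^n → ℝ a linear functional, d ∈ ℝ and w > 0, and let B := {s ∈ S : C s ∈ [d − w, d]}. Suppose: (i) B is the convex hull of a finite set V ⊆ ℝ^n; (ii) π : ℝ^n → ℝ^m is affine on B and π(s) ∈ U for all s ∈ B; (iii) ε ≥ 0 is an approximation measure of f with respect to C, B and U; (iv) the repulsion condition C(f(v, π(v))) ≤ −2ε holds for every vertex v ∈ V. Then every trajectory s : ℝ → ℝ^n that is differentiable on [0, ∞) with s'(t) = f(s(t), π(s(t))) for all t ≥ 0, that satisfies s(t) ∈ S for all t ≥ 0, and that starts safely with C(s(0)) < d, satisfies C(s(t)) < d for all t ≥ 0. -/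
/-- A real function on `[0, ∞)` whose derivative is nonpositive whenever its value lies in
`[d - w, d]` never reaches `d` if it starts below `d`. -/
theorem lt_of_deriv_nonpos_on_band {h h' : ℝ → ℝ} {d w : ℝ} (hw : 0 < w)
    (hderiv : ∀ t, 0 ≤ t → HasDerivAt h (h' t) t)
    (hband : ∀ t, 0 ≤ t → h t ∈ Set.Icc (d - w) d → h' t ≤ 0)
    (h0 : h 0 < d) {T : ℝ} (hT : 0 ≤ T) : h T < d := by
  obtain ⟨M, hM0, hMw, hMd⟩ : ∃ M, h 0 ≤ M ∧ d - w ≤ M ∧ M < d :=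
    ⟨max (h 0) (d - w), le_max_left _ _, le_max_right _ _, max_lt h0 (by linarith)⟩
  obtain ⟨δ, hδ, hδT⟩ : ∃ δ > 0, M + δ * T < d := by
    refine ⟨(d - M) / (T + 1), div_pos (by linarith) (by linarith), ?_⟩
    have : (d - M) / (T + 1) * T < d - M := by
      rw [div_mul_eq_mul_div, div_lt_iff₀ (by linarith)]
      nlinarith
    linarith
  have hbarrier (t : ℝ) : HasDerivAt (fun t => M + δ * t) δ t := by
    simpa using ((hasDerivAt_id t).const_mul δ).const_add M
  have hle : h T ≤ M + δ * T :=
    image_le_of_deriv_right_lt_deriv_boundary (a := 0) (b := T) (f' := h')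
      (B' := fun _ => δ)
      (fun t ht => (hderiv t ht.1).continuousAt.continuousWithinAt)
      (fun t ht => (hderiv t ht.1).hasDerivWithinAt) (by simpa using hM0) hbarrier
      (fun t ht heq => by
        refine (hband t ht.1 ⟨?_, ?_⟩).trans_lt hδ
        · nlinarith [ht.1]
        · nlinarith [ht.2]) ⟨hT, le_rfl⟩
  exact hle.trans_lt hδT

/-- **Theorem 1 (POLICEd-RL safety of a single mode).**
If the policy `π` is affine on the buffer
`B = {s ∈ S : C s ∈ [d − w, d]}`, `B` is the convex hull of a finite vertex set `V`,
`ε ≥ 0` is an approximation measure of the dynamics `f` with respect to `C`, `B`, `U`,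
and the repulsion condition `C (f v (π v)) ≤ −2ε` holds at every vertex `v ∈ V`,
then every closed-loop trajectory remaining in `S` that starts with `C (s 0) < d`
satisfies `C (s t) < d` for all `t ≥ 0`. -/
theorem mode_safety
    (n m : ℕ)
    (f : (Fin n → ℝ) → (Fin m → ℝ) → (Fin n → ℝ))
    (S : Set (Fin n → ℝ)) (U : Set (Fin m → ℝ))
    (C : (Fin n → ℝ) →ₗ[ℝ] ℝ) (d w : ℝ) (hw : 0 < w)
    (B : Set (Fin n → ℝ))
    (hB : B = {s ∈ S | C s ∈ Set.Icc (d - w) d})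
    -- (i) B is the convex hull of a finite set V
    (V : Set (Fin n → ℝ)) (hVfin : V.Finite)
    (hBhull : B = convexHull ℝ V)
    -- (ii) π is affine on B with values in U
    (π : (Fin n → ℝ) → (Fin m → ℝ))
    (D : (Fin n → ℝ) →ₗ[ℝ] (Fin m → ℝ)) (e : Fin m → ℝ)
    (hπaff : ∀ s ∈ B, π s = D s + e)
    (hπU : ∀ s ∈ B, π s ∈ U)
    -- (iii) ε is an approximation measure of f w.r.t. C, B and U
    (ε : ℝ) (hε : 0 ≤ ε)
    (hmeas : ∃ (A : (Fin n → ℝ) →ₗ[ℝ] (Fin n → ℝ))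
      (B' : (Fin m → ℝ) →ₗ[ℝ] (Fin n → ℝ)) (c : Fin n → ℝ),
      ∀ s ∈ B, ∀ u ∈ U, |C (f s u) - C (A s + B' u + c)| ≤ ε)
    -- (iv) repulsion condition at the vertices
    (hrep : ∀ v ∈ V, C (f v (π v)) ≤ -2 * ε)
    -- trajectory
    (s : ℝ → (Fin n → ℝ))
    (hdiff : ∀ t : ℝ, 0 ≤ t → HasDerivAt s (f (s t) (π (s t))) t)
    (hS : ∀ t : ℝ, 0 ≤ t → s t ∈ S)
    (h0 : C (s 0) < d) :
    ∀ t : ℝ, 0 ≤ t → C (s t) < d := by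
  obtain ⟨A, B', c, hmeas⟩ := hmeas
  have hVB : V ⊆ B := hBhull ▸ subset_convexHull ℝ V
  have happrox : ∀ x ∈ B, |C (f x (π x)) - (C (A x + B' (D x)) + C (B' e + c))| ≤ ε := by
    intro x hx
    have hx' := hmeas x hx (π x) (hπU x hx)
    have heq : A x + B' (π x) + c = (A x + B' (D x)) + (B' e + c) := by
      rw [hπaff x hx, map_add]
      abel
    rwa [heq, map_add C (A x + B' (D x))] at hx'
  have hlin : ∀ x ∈ B, C (A x + B' (D x)) ≤ -ε - C (B' e + c) := by
    have hconv : Convex ℝ {x | C (A x + B' (D x)) ≤ -ε - C (B' e + c)} :=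
      convex_halfSpace_le (C ∘ₗ (A + B' ∘ₗ D)).isLinear _
    rw [hBhull]
    refine convexHull_min (fun v hv => ?_) hconv
    have h₁ := (abs_le.mp (happrox v (hVB hv))).1
    have h₂ := hrep v hv
    change C (A v + B' (D v)) ≤ -ε - C (B' e + c)
    linarith
  have hnonpos : ∀ x ∈ B, C (f x (π x)) ≤ 0 := by
    intro x hx
    have h₁ := (abs_le.mp (happrox x hx)).2
    have h₂ := hlin x hx
    linarith
  intro T hT
  refine lt_of_deriv_nonpos_on_band (h := fun t => C (s t))
    (h' := fun t => C (f (s t) (π (s t)))) hw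
    (fun t ht => C.toContinuousLinearMap.hasFDerivAt.comp_hasDerivAt t (hdiff t ht))
    (fun t ht hband => hnonpos _ ?_) h0 hT
  rw [hB]
  exact ⟨hS t ht, hband⟩
end

section
/- Let n, m be natural numbers, f : ℝ^n × ℝ^m → ℝ^n, C : ℝ^n → ℝ a linear functional, U ⊆ ℝ^m, ε ≥ 0, and let A : ℝ^n → ℝ^n, B' : ℝ^m → ℝ^n be linear maps and c ∈ ℝ^n be such that |C(f(s,u)) − C(A s + B' u + c)| ≤ ε for all s ∈ B and all u ∈ U, where B ⊆ ℝ^n is the convex hull of a finite set V. Suppose π : ℝ^n → ℝ^m is affine on B with π(s) ∈ U for all s ∈ B, and that C(f(v, π(v))) ≤ −2ε for every v ∈ V. Then C(f(s, π(s))) ≤ 0 for every s ∈ B; i.e., under the policy π the time-derivative of the output y = C s is nonpositive everywhere in the buffer B. -/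
/-- The key inequality `C ṡ ≤ 0` on the buffer from the proof of Theorem 1:
under an affine policy on the buffer `B = convexHull ℝ V`, an affine approximation
measure `ε` of the dynamics, and the repulsion condition at the vertices,
the time-derivative of the output `y = C s` is nonpositive everywhere in `B`. -/
theorem derivative_nonpos_on_buffer
    (n m : ℕ)
    (f : (Fin n → ℝ) → (Fin m → ℝ) → (Fin n → ℝ))
    (C : (Fin n → ℝ) →ₗ[ℝ] ℝ)
    (U : Set (Fin m → ℝ))
    (ε : ℝ) (hε : 0 ≤ ε)
    (A : (Fin n → ℝ) →ₗ[ℝ] (Fin n → ℝ))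
    (B' : (Fin m → ℝ) →ₗ[ℝ] (Fin n → ℝ)) (c : Fin n → ℝ)
    (V : Set (Fin n → ℝ)) (hVfin : V.Finite)
    (B : Set (Fin n → ℝ)) (hBhull : B = convexHull ℝ V)
    (happrox : ∀ s ∈ B, ∀ u ∈ U, |C (f s u) - C (A s + B' u + c)| ≤ ε)
    (π : (Fin n → ℝ) → (Fin m → ℝ))
    (D : (Fin n → ℝ) →ₗ[ℝ] (Fin m → ℝ)) (e : Fin m → ℝ)
    (hπaff : ∀ s ∈ B, π s = D s + e)
    (hπU : ∀ s ∈ B, π s ∈ U)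
    (hrep : ∀ v ∈ V, C (f v (π v)) ≤ -2 * ε) :
    ∀ s ∈ B, C (f s (π s)) ≤ 0 := by
  subst hBhull
  have hhalf : convexHull ℝ V ⊆
      {s | (C ∘ₗ (A + B' ∘ₗ D)) s ≤ -ε - C (B' e) - C c} := by
    refine convexHull_min (fun v hv => ?_) (convex_halfSpace_le (LinearMap.isLinear _) _)
    have hvB := subset_convexHull ℝ V hv
    have happ := (abs_le.mp (happrox v hvB (π v) (hπU v hvB))).1
    have hneg := hrep v hv
    rw [hπaff v hvB] at happ hneg
    simp only [map_add] at happ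
    simp only [Set.mem_ofPred_eq, LinearMap.comp_apply, LinearMap.add_apply, map_add]
    linarith
  intro s hs
  have happ := (abs_le.mp (happrox s hs (π s) (hπU s hs))).2
  have hle := hhalf hs
  rw [hπaff s hs] at happ ⊢
  simp only [map_add] at happ
  simp only [Set.mem_ofPred_eq, LinearMap.comp_apply, LinearMap.add_apply, map_add] at hle
  linarith
end

section
/- Let d ∈ ℝ and w > 0, and let y : ℝ → ℝ be differentiable on [0, ∞) with y(0) < d. If the derivative satisfies y'(t) ≤ 0 at every time t ≥ 0 for which y(t) ∈ [d − w, d], then y(t) < d for all t ≥ 0. -/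
/-- Real-analysis core of the invariance argument in Theorem 1:
a differentiable output signal `y` with `y 0 < d` whose derivative is
nonpositive whenever `y t ∈ [d − w, d]` satisfies `y t < d` for all `t ≥ 0`. -/
theorem output_invariance
    (d w : ℝ) (hw : 0 < w)
    (y : ℝ → ℝ) (y' : ℝ → ℝ)
    (hdiff : ∀ t : ℝ, 0 ≤ t → HasDerivAt y (y' t) t)
    (h0 : y 0 < d)
    (hder : ∀ t : ℝ, 0 ≤ t → y t ∈ Set.Icc (d - w) d → y' t ≤ 0) :
    ∀ t : ℝ, 0 ≤ t → y t < d := by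
  intro t ht
  -- Compare `y` on `[0, t]` with a line rising from `max (y 0) (d - w)` but staying below `d`.
  obtain ⟨m, hm0, hmw, hmd⟩ : ∃ m, y 0 ≤ m ∧ d - w ≤ m ∧ m < d :=
    ⟨max (y 0) (d - w), le_max_left _ _, le_max_right _ _, max_lt h0 (by linarith)⟩
  have ht1 : 0 < t + 1 := by linarith
  obtain ⟨c, hc, hct⟩ : ∃ c : ℝ, 0 < c ∧ c * (t + 1) = d - m :=
    ⟨(d - m) / (t + 1), div_pos (by linarith) ht1, div_mul_cancel₀ _ ht1.ne'⟩
  have hline : ∀ x, HasDerivAt (fun x : ℝ => m + c * x) c x := fun x => by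
    simpa using ((hasDerivAt_id x).const_mul c).const_add m
  have hle : y t ≤ m + c * t :=
    image_le_of_deriv_right_lt_deriv_boundary (f := y) (f' := y') (a := 0) (b := t)
      (fun x hx => (hdiff x hx.1).continuousAt.continuousWithinAt)
      (fun x hx => (hdiff x hx.1).hasDerivWithinAt) (by simpa using hm0) hline
      (fun x hx hyx => (hder x hx.1
        ⟨by nlinarith [mul_nonneg hc.le hx.1],
          by nlinarith [mul_lt_mul_of_pos_left hx.2 hc]⟩).trans_lt hc)
      ⟨ht, le_rfl⟩
  linarith
end

section
/- Let n, m be natural numbers, f : ℝ^n × ℝ^m → ℝ^n, S ⊆ ℝ^n, U ⊆ ℝ^m, C : ℝ^n → ℝ a linear functional, M : ℝ^n → ℝ^n a linear map, p ∈ ℝ^n, d ∈ ℝ and w > 0. Define the linear functional C̃ : ℝ^n → ℝ by C̃(s) := C(M s) and set d̃ := d − C(p), and let B_J := {s ∈ S : C̃ s ∈ [d̃ − w, d̃]}. Suppose: (i) B_J is the convex hull of a finite set V ⊆ ℝ^n; (ii) π : ℝ^n → ℝ^m is affine on B_J and π(s) ∈ U for all s ∈ B_J; (iii) ε ≥ 0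 is an approximation measure of f with respect to C̃, B_J and U; (iv) C̃(f(v, π(v))) ≤ −2ε for every v ∈ V. Then every trajectory s : ℝ → ℝ^n that is differentiable on [0, ∞) with s'(t) = f(s(t), π(s(t))) for all t ≥ 0, that satisfies s(t) ∈ S for all t ≥ 0, and with C̃(s(0)) < d̃, satisfies C̃(s(t)) < d̃ for all t ≥ 0; consequently C(M s(t) + p) < d for all t ≥ 0, i.e., the trajectory never reaches the constraint-violating jump set J := {s ∈ ℝ^n : C(M s + p) > d} and the image of any state on the trajectory under the affine reset map R(s) = M s + p always satisfies the constraint C(R(s(t))) < d. -/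
/-- A real function cannot reach the upper end of a band in which its derivative is nonpositive. -/
theorem lt_of_deriv_nonpos_on_band_s5 {g g' : ℝ → ℝ} {b w : ℝ} (hw : 0 < w)
    (hg : ∀ t, 0 ≤ t → HasDerivAt g (g' t) t)
    (hband : ∀ t, 0 ≤ t → g t ∈ Set.Icc (b - w) b → g' t ≤ 0)
    (h0 : g 0 < b) {t : ℝ} (ht : 0 ≤ t) : g t < b := by
  set q := max (g 0) (b - w)
  have hqb : q < b := max_lt h0 (by linarith)
  set δ := (b - q) / (t + 1)
  have hδpos : 0 < δ := div_pos (by linarith) (by linarith)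
  have hδt : q + δ * t < b := by
    have h : δ * (t + 1) = b - q := div_mul_cancel₀ _ (by linarith)
    linarith
  have key : g t ≤ q + δ * t := by
    refine image_le_of_deriv_right_lt_deriv_boundary (f := g) (f' := g') (a := 0) (b := t)
      (B := fun x => q + δ * x) (B' := fun _ => δ)
      (fun x hx => (hg x hx.1).continuousAt.continuousWithinAt)
      (fun x hx => (hg x hx.1).hasDerivWithinAt) ?_ ?_ ?_ ⟨ht, le_rfl⟩
    · simp [q]
    · intro x
      simpa using ((hasDerivAt_id x).const_mul δ).const_add q
    · intro x hx hgx
      refine (hband x hx.1 ?_).trans_lt hδpos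
      have h1 : b - w ≤ q := le_max_right _ _
      have h2 : 0 ≤ δ * x := mul_nonneg hδpos.le hx.1
      have h3 : δ * x ≤ δ * t := mul_le_mul_of_nonneg_left hx.2.le hδpos.le
      constructor <;> linarith
  exact key.trans_lt hδt

/-- An affine functional bounded above on a set is bounded above on its convex hull. -/
theorem LinearMap.add_const_le_of_mem_convexHull {E : Type*} [AddCommGroup E] [Module ℝ E]
    (φ : E →ₗ[ℝ] ℝ) (k r : ℝ) {V : Set E} (hV : ∀ v ∈ V, φ v + k ≤ r) {x : E}
    (hx : x ∈ convexHull ℝ V) : φ x + k ≤ r := by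
  have hsub : convexHull ℝ V ⊆ {y | φ y ≤ r - k} :=
    convexHull_min (fun v hv => le_sub_iff_add_le.mpr (hV v hv))
      (convex_halfSpace_le φ.isLinear _)
  exact le_sub_iff_add_le.mp (hsub hx)

/-- **Lemma 1 (safety w.r.t. the jump constraint, relative degree one).**
With the induced jump constraint `C̃ s ≤ d̃` where `C̃ s = C (M s)` and
`d̃ = d − C p`, a repulsive affine buffer
`B_J = {s ∈ S : C̃ s ∈ [d̃ − w, d̃]}` before the jump set guarantees that
trajectories never reach a pre-reset state whose reset `R s = M s + p`
would violate the constraint `C s ≤ d`. -/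
theorem jump_constraint_safety
    (n m : ℕ)
    (f : (Fin n → ℝ) → (Fin m → ℝ) → (Fin n → ℝ))
    (S : Set (Fin n → ℝ)) (U : Set (Fin m → ℝ))
    (C : (Fin n → ℝ) →ₗ[ℝ] ℝ)
    (M : (Fin n → ℝ) →ₗ[ℝ] (Fin n → ℝ)) (p : Fin n → ℝ)
    (d w : ℝ) (hw : 0 < w)
    (C' : (Fin n → ℝ) →ₗ[ℝ] ℝ) (hC' : ∀ x, C' x = C (M x))
    (d' : ℝ) (hd' : d' = d - C p)
    (BJ : Set (Fin n → ℝ))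
    (hBJ : BJ = {s ∈ S | C' s ∈ Set.Icc (d' - w) d'})
    -- (i) B_J is the convex hull of a finite set V
    (V : Set (Fin n → ℝ)) (hVfin : V.Finite)
    (hBJhull : BJ = convexHull ℝ V)
    -- (ii) π is affine on B_J with values in U
    (π : (Fin n → ℝ) → (Fin m → ℝ))
    (D : (Fin n → ℝ) →ₗ[ℝ] (Fin m → ℝ)) (e : Fin m → ℝ)
    (hπaff : ∀ s ∈ BJ, π s = D s + e)
    (hπU : ∀ s ∈ BJ, π s ∈ U)
    -- (iii) ε is an approximation measure of f w.r.t. C̃, B_J and U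
    (ε : ℝ) (hε : 0 ≤ ε)
    (hmeas : ∃ (A : (Fin n → ℝ) →ₗ[ℝ] (Fin n → ℝ))
      (B' : (Fin m → ℝ) →ₗ[ℝ] (Fin n → ℝ)) (c : Fin n → ℝ),
      ∀ s ∈ BJ, ∀ u ∈ U, |C' (f s u) - C' (A s + B' u + c)| ≤ ε)
    -- (iv) repulsion condition at the vertices
    (hrep : ∀ v ∈ V, C' (f v (π v)) ≤ -2 * ε)
    -- trajectory
    (s : ℝ → (Fin n → ℝ))
    (hdiff : ∀ t : ℝ, 0 ≤ t → HasDerivAt s (f (s t) (π (s t))) t)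
    (hS : ∀ t : ℝ, 0 ≤ t → s t ∈ S)
    (h0 : C' (s 0) < d') :
    (∀ t : ℝ, 0 ≤ t → C' (s t) < d') ∧
    (∀ t : ℝ, 0 ≤ t → C (M (s t) + p) < d) ∧
    (∀ t : ℝ, 0 ≤ t → s t ∉ {x : Fin n → ℝ | C (M x + p) > d}) := by
  obtain ⟨A, B', c, hA⟩ := hmeas
  have hVB : V ⊆ BJ := hBJhull ▸ subset_convexHull ℝ V
  have happrox : ∀ x ∈ BJ, C' (A x + B' (π x) + c)
      = (C' ∘ₗ (A + B' ∘ₗ D)) x + C' (B' e + c) := by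
    intro x hx
    simp only [hπaff x hx, map_add, LinearMap.comp_apply, LinearMap.add_apply]
    ring
  have hvert : ∀ v ∈ V, (C' ∘ₗ (A + B' ∘ₗ D)) v + C' (B' e + c) ≤ -ε := by
    intro v hv
    rw [← happrox v (hVB hv)]
    have h1 := (abs_le.mp (hA v (hVB hv) _ (hπU v (hVB hv)))).1
    have h2 := hrep v hv
    linarith
  have hflow : ∀ x ∈ BJ, C' (f x (π x)) ≤ 0 := by
    intro x hx
    have h1 := LinearMap.add_const_le_of_mem_convexHull _ _ _ hvert (hBJhull ▸ hx)
    rw [← happrox x hx] at h1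
    have h2 := (abs_le.mp (hA x hx _ (hπU x hx))).2
    linarith
  have hsafe : ∀ t : ℝ, 0 ≤ t → C' (s t) < d' := by
    intro t ht
    refine lt_of_deriv_nonpos_on_band_s5 (g := fun τ => C' (s τ))
      (g' := fun τ => C' (f (s τ) (π (s τ)))) hw ?_ ?_ h0 ht
    · intro τ hτ
      exact (LinearMap.toContinuousLinearMap C').hasFDerivAt.comp_hasDerivAt τ (hdiff τ hτ)
    · intro τ hτ hb
      exact hflow _ (hBJ ▸ ⟨hS τ hτ, hb⟩)
  have hreset : ∀ t : ℝ, 0 ≤ t → C (M (s t) + p) < d := by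
    intro t ht
    have h := hsafe t ht
    rw [hC', hd'] at h
    rw [map_add]
    linarith
  exact ⟨hsafe, hreset, fun t ht h => lt_asymm (hreset t ht) h⟩
end

section
/- Let d̃ ∈ ℝ, β > 0, and t₀ ≤ T be real numbers, and let y : ℝ → ℝ be twice differentiable on [t₀, T]. Assume the entry conditions y(t₀) ≤ d̃ and y'(t₀) ≤ β(d̃ − y(t₀)), and assume the dissipation inequality y''(t) ≤ −β y'(t) holds for all t ∈ [t₀, T]. Then for all t ∈ [t₀, T] one has both y'(t) ≤ β(d̃ − y(t)) and y(t) ≤ d̃; in particular, if y(T) = d̃ then y'(T) ≤ 0. -/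
/-- A function with nonpositive derivative at every point of a closed interval is antitone there. -/
theorem antitoneOn_Icc_of_hasDerivAt_nonpos {f f' : ℝ → ℝ} {a b : ℝ}
    (hf : ∀ t ∈ Set.Icc a b, HasDerivAt f (f' t) t)
    (hf' : ∀ t ∈ Set.Icc a b, f' t ≤ 0) : AntitoneOn f (Set.Icc a b) :=
  antitoneOn_of_hasDerivWithinAt_nonpos (convex_Icc a b)
    (fun t ht => (hf t ht).continuousAt.continuousWithinAt)
    (fun t ht => (hf t (interior_subset ht)).hasDerivWithinAt)
    (fun t ht => hf' t (interior_subset ht))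

/-- Linear Grönwall comparison: `u' ≤ -β u` preserves nonpositivity. -/
theorem nonpos_of_hasDerivAt_le_neg_mul {u u' : ℝ → ℝ} {a b β : ℝ}
    (hu : ∀ t ∈ Set.Icc a b, HasDerivAt u (u' t) t)
    (hle : ∀ t ∈ Set.Icc a b, u' t ≤ -β * u t) (ha : u a ≤ 0) :
    ∀ t ∈ Set.Icc a b, u t ≤ 0 := by
  have hexp (t : ℝ) : HasDerivAt (fun s => Real.exp (β * s)) (Real.exp (β * t) * β) t := by
    simpa using ((hasDerivAt_id t).const_mul β).exp
  have hanti : AntitoneOn (fun s => Real.exp (β * s) * u s) (Set.Icc a b) := by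
    refine antitoneOn_Icc_of_hasDerivAt_nonpos (fun t ht => (hexp t).mul (hu t ht))
      (fun t ht => ?_)
    have := mul_nonpos_of_nonneg_of_nonpos (Real.exp_pos (β * t)).le
      (show β * u t + u' t ≤ 0 by linarith [hle t ht])
    linarith
  intro t ht
  have h := hanti (Set.left_mem_Icc.2 (ht.1.trans ht.2)) ht ht.1
  have h0 := mul_nonpos_of_nonneg_of_nonpos (Real.exp_pos (β * a)).le ha
  exact nonpos_of_mul_nonpos_right (h.trans h0) (Real.exp_pos _)

/-- Analytic core of Theorem 2: for a relative-degree-two output `y` entering the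
dissipative buffer (entry conditions `y t₀ ≤ d̃` and `y' t₀ ≤ β (d̃ − y t₀)`),
the dissipation condition `y'' ≤ −β y'` on `[t₀, T]` forces
`y' t ≤ β (d̃ − y t)` and `y t ≤ d̃` throughout `[t₀, T]`;
in particular, if `y T = d̃` then `y' T ≤ 0`. -/
theorem dissipative_buffer_invariance
    (dtil β t₀ T : ℝ) (hβ : 0 < β) (hT : t₀ ≤ T)
    (y y' y'' : ℝ → ℝ)
    (hd1 : ∀ t ∈ Set.Icc t₀ T, HasDerivAt y (y' t) t)
    (hd2 : ∀ t ∈ Set.Icc t₀ T, HasDerivAt y' (y'' t) t)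
    (hentry₁ : y t₀ ≤ dtil)
    (hentry₂ : y' t₀ ≤ β * (dtil - y t₀))
    (hdiss : ∀ t ∈ Set.Icc t₀ T, y'' t ≤ -β * y' t) :
    (∀ t ∈ Set.Icc t₀ T, y' t ≤ β * (dtil - y t) ∧ y t ≤ dtil) ∧
      (y T = dtil → y' T ≤ 0) := by
  have hanti : AntitoneOn (fun s => y' s + β * y s) (Set.Icc t₀ T) :=
    antitoneOn_Icc_of_hasDerivAt_nonpos
      (fun t ht => (hd2 t ht).add ((hd1 t ht).const_mul β))
      (fun t ht => by linarith [hdiss t ht])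
  have hvel : ∀ t ∈ Set.Icc t₀ T, y' t ≤ β * (dtil - y t) := by
    intro t ht
    have h : y' t + β * y t ≤ y' t₀ + β * y t₀ := hanti (Set.left_mem_Icc.2 hT) ht ht.1
    linarith
  have hpos : ∀ t ∈ Set.Icc t₀ T, y t - dtil ≤ 0 :=
    nonpos_of_hasDerivAt_le_neg_mul (β := β) (fun t ht => (hd1 t ht).sub_const dtil)
      (fun t ht => by linarith [hvel t ht]) (sub_nonpos.2 hentry₁)
  refine ⟨fun t ht => ⟨hvel t ht, sub_nonpos.1 (hpos t ht)⟩, fun h => ?_⟩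
  simpa [h] using hvel T (Set.right_mem_Icc.2 hT)
end

section
/- Let n, m be natural numbers, g : ℝ^n × ℝ^m → ℝ, C̃ : ℝ^n → ℝ a linear functional, U ⊆ ℝ^m, ε ≥ 0, β ∈ ℝ, and let L : ℝ^n → ℝ be an affine function (i.e., L(s) = ℓ(s) + ℓ₀ for a linear functional ℓ and a constant ℓ₀). Let A : ℝ^n → ℝ^n, B' : ℝ^m → ℝ^n be linear maps and c ∈ ℝ^n be such that |g(s,u) − C̃(A s + B' u + c)| ≤ ε for all s ∈ B_J and all u ∈ U, where B_J ⊆ ℝ^n is the convex hull of a finite set V. Suppose π : ℝ^n → ℝ^m is affine on B_J with π(s) ∈ U for all s ∈ B_J, and that g(v, π(v)) ≤ −2ε − β L(v) for every v ∈ V. Then C̃(A s + B' π(s) + c) ≤ −ε − β L(s) for every s ∈ B_J, and consequently g(s, π(s)) ≤ −β L(s) for every s ∈ B_J. -/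
/-- Convex-combination step of the appendix proof of Theorem 2: from the affine
approximation of `g` (the second time-derivative of the output) on the buffer
`B_J = convexHull ℝ V`, an affine policy on `B_J`, and the vertex condition
`g v (π v) ≤ −2ε − β L v`, deduce
`C̃ (A s + B' (π s) + c) ≤ −ε − β L s` and `g s (π s) ≤ −β L s` on all of `B_J`,
where `L` is affine in the state. -/
theorem dissipation_bound_on_buffer
    (n m : ℕ)
    (g : (Fin n → ℝ) → (Fin m → ℝ) → ℝ)
    (C' : (Fin n → ℝ) →ₗ[ℝ] ℝ)
    (U : Set (Fin m → ℝ))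
    (ε β : ℝ) (hε : 0 ≤ ε)
    (ℓ : (Fin n → ℝ) →ₗ[ℝ] ℝ) (ℓ₀ : ℝ)
    (L : (Fin n → ℝ) → ℝ) (hL : ∀ x, L x = ℓ x + ℓ₀)
    (A : (Fin n → ℝ) →ₗ[ℝ] (Fin n → ℝ))
    (B' : (Fin m → ℝ) →ₗ[ℝ] (Fin n → ℝ)) (c : Fin n → ℝ)
    (V : Set (Fin n → ℝ)) (hVfin : V.Finite)
    (BJ : Set (Fin n → ℝ)) (hBJhull : BJ = convexHull ℝ V)
    (happrox : ∀ s ∈ BJ, ∀ u ∈ U, |g s u - C' (A s + B' u + c)| ≤ ε)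
    (π : (Fin n → ℝ) → (Fin m → ℝ))
    (D : (Fin n → ℝ) →ₗ[ℝ] (Fin m → ℝ)) (e : Fin m → ℝ)
    (hπaff : ∀ s ∈ BJ, π s = D s + e)
    (hπU : ∀ s ∈ BJ, π s ∈ U)
    (hvert : ∀ v ∈ V, g v (π v) ≤ -2 * ε - β * L v) :
    ∀ s ∈ BJ, C' (A s + B' (π s) + c) ≤ -ε - β * L s ∧ g s (π s) ≤ -β * L s := by
  have hsub : V ⊆ BJ := hBJhull ▸ subset_convexHull ℝ V
  let f : (Fin n → ℝ) →ₗ[ℝ] ℝ := C' ∘ₗ (A + B' ∘ₗ D) + β • ℓ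
  have hf : ∀ s ∈ BJ, C' (A s + B' (π s) + c) + β * L s = f s + (C' (B' e + c) + β * ℓ₀) := by
    intro s hs
    simp only [f, hπaff s hs, hL, map_add, LinearMap.add_apply, LinearMap.comp_apply,
      LinearMap.smul_apply, smul_eq_mul]
    ring
  have hBJ : BJ ⊆ {s | f s ≤ -ε - (C' (B' e + c) + β * ℓ₀)} := by
    rw [hBJhull]
    refine convexHull_min (fun v hv => ?_) (convex_halfSpace_le f.isLinear _)
    have happ := abs_le.mp (happrox v (hsub hv) (π v) (hπU v (hsub hv)))
    rw [Set.mem_ofPred_eq]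
    linarith [hf v (hsub hv), hvert v hv]
  intro s hs
  have hmodel : C' (A s + B' (π s) + c) ≤ -ε - β * L s := by
    have hfs : f s ≤ -ε - (C' (B' e + c) + β * ℓ₀) := hBJ hs
    linarith [hf s hs]
  have happ := abs_le.mp (happrox s hs (π s) (hπU s hs))
  exact ⟨hmodel, by linarith⟩
end
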